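/- Consider a weighted 2-colored complete graph on the vertex set {1, …, 10} (each pair of distinct vertices has a weight in {1/2, 1} and a color, red or blue) which contains no blue triangle and no red generalized K₆, and whose density g(w) = max over the standard simplex of Σ_{1 ≤ i < j ≤ 10} w(i, j)·u_i·u_j satisfies g(w) ≥ 5/12. Then every vertex is incident to at least two edges of weight 1/2. -/

import Mathlib

lemma aux_K4 (a b c d : ℝ) : 5 / 8 * (a + b + c + d) ^ 2 ≤
    a ^ 2 + b ^ 2 + c ^ 2 + d ^ 2 + a * b + a * c + a * d + b * c + b * d + c * d := by
  nlinarith [sq_nonneg (a - b), sq_nonneg (a - c), sq_nonneg (a - d), sq_nonneg (b - c),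
    sq_nonneg (b - d), sq_nonneg (c - d)]

lemma aux_P4 (a b c d : ℝ) : 5 / 12 * (a + b + c + d) ^ 2 ≤
    a ^ 2 + b ^ 2 + c ^ 2 + d ^ 2 + a * b + b * c + c * d := by
  nlinarith [sq_nonneg ((7) * a + (1) * b + (-5) * c + (-5) * d),
    sq_nonneg ((8) * b + (2) * c + (-5) * d),
    sq_nonneg ((2) * c + (-1) * d)]

lemma aux_C5 (a b c d e : ℝ) : 2 / 5 * (a + b + c + d + e) ^ 2 ≤
    a ^ 2 + b ^ 2 + c ^ 2 + d ^ 2 + e ^ 2 + a * b + b * c + c * d + d * e + e * a := by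
  nlinarith [sq_nonneg ((6) * a + (1) * b + (-4) * c + (-4) * d + (1) * e),
    sq_nonneg ((7) * b + (2) * c + (-4) * d + (-5) * e),
    sq_nonneg ((4) * c + (-1) * d + (-3) * e),
    sq_nonneg ((1) * d + (-1) * e)]

lemma aux_edge (x y : ℝ) : 3 / 4 * (x + y) ^ 2 ≤ x ^ 2 + y ^ 2 + x * y := by
  nlinarith [sq_nonneg (x - y)]

lemma aux_fin1 (A C : ℝ)
    (h : 5 / 8 * A ^ 2 + 5 / 12 * C ^ 2 + 3 / 4 * (1 - A - C) ^ 2 ≤ 1 / 6) : False := by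
  nlinarith [sq_nonneg (A - 3 / 10), sq_nonneg (C - 9 / 20), sq_nonneg (A + C - 3 / 4)]

lemma aux_fin2 (A C : ℝ)
    (h : 5 / 8 * A ^ 2 + 2 / 5 * C ^ 2 + (1 - A - C) ^ 2 ≤ 1 / 6) : False := by
  nlinarith [sq_nonneg (A - 16 / 51), sq_nonneg (C - 25 / 51), sq_nonneg (A + C - 41 / 51)]

/-- Row expansion for a sum over ten distinct labels. -/
lemma aux_sum (l : List (Fin 10)) (hl : l.Nodup) (hlen : l.length = 10) (F : Fin 10 → ℝ) :
    ∑ i, F i = (l.map F).sum := by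
  have h : l.toFinset = Finset.univ := by
    apply Finset.eq_univ_of_card
    rw [List.toFinset_card_of_nodup hl, hlen]; simp
  rw [← h, List.sum_toFinset F hl]

set_option maxHeartbeats 2000000 in
lemma aux_density (w : Fin 10 → Fin 10 → ℝ)
    (hwsymm : ∀ i j, w i j = w j i)
    (hwval : ∀ i j : Fin 10, i ≠ j → w i j = 1 / 2 ∨ w i j = 1)
    (u : Fin 10 → ℝ) (hu : ∀ i, 0 ≤ u i) (hs : ∑ i, u i = 1)
    (hd : 5 / 12 ≤ ∑ i, ∑ j, if i < j then w i j * u i * u j else 0)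
    (v p q r s a b c d e : Fin 10) (hl : [v, p, q, r, s, a, b, c, d, e].Nodup)
    (h1 : w p q = 1 / 2) (h2 : w p r = 1 / 2) (h3 : w p s = 1 / 2)
    (h4 : w q r = 1 / 2) (h5 : w q s = 1 / 2) (h6 : w r s = 1 / 2)
    (h7 : w b c = 1 / 2) (h8 : w c d = 1 / 2) (h9 : w d e = 1 / 2)
    (h10 : w v a = 1 / 2 ∨ (w a b = 1 / 2 ∧ w e a = 1 / 2)) : False := by
  obtain ⟨E, hE⟩ : ∃ E : Fin 10 → Fin 10 → ℝ,
      E = fun i j => if i = j then u i * u j else (1 - w i j) * u i * u j := ⟨_, rfl⟩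
  have hEd : ∀ i, E i i = u i ^ 2 := by intro i; simp [hE]; ring
  have hEn : ∀ i j, 0 ≤ E i j := by
    intro i j
    have hi := hu i
    have hj := hu j
    simp only [hE]
    split_ifs with h
    · positivity
    · rcases hwval i j h with h | h <;> rw [h] <;> norm_num
      positivity
  have hEs : ∀ i j, E i j = E j i := by
    intro i j
    simp only [hE, hwsymm i j, eq_comm (a := i) (b := j)]
    split_ifs <;> ring
  have hEh : ∀ i j, i ≠ j → w i j = 1 / 2 → E i j = 1 / 2 * (u i * u j) := by
    intro i j h h'
    simp only [hE, if_neg h, h']; ring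
  have htot : ∑ i, ∑ j, E i j ≤ 1 / 6 := by
    have e1 : ∑ i, ∑ j, u i * u j = 1 := by
      rw [← Finset.sum_mul_sum, hs, one_mul]
    have e2 : ∑ i, ∑ j, (if j < i then w i j * u i * u j else 0)
        = ∑ i, ∑ j, if i < j then w i j * u i * u j else 0 := by
      rw [Finset.sum_comm]
      refine Finset.sum_congr rfl fun i _ => Finset.sum_congr rfl fun j _ => ?_
      rw [hwsymm j i]; split_ifs <;> ring
    have e3 : ∑ i, ∑ j, E i j = ∑ i, ∑ j, u i * u j
        - ∑ i, ∑ j, (if i < j then w i j * u i * u j else 0)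
        - ∑ i, ∑ j, (if j < i then w i j * u i * u j else 0) := by
      simp only [← Finset.sum_sub_distrib]
      refine Finset.sum_congr rfl fun i _ => Finset.sum_congr rfl fun j _ => ?_
      simp only [hE]
      rcases lt_trichotomy i j with h | h | h
      · simp [h, h.ne, h.not_gt]; ring
      · simp [h]
      · simp [h, h.ne', h.not_gt]; ring
    linarith
  have hrow : ∀ i, ∑ j, E i j = E i v + (E i p + (E i q + (E i r + (E i s + (E i a + (E i b
      + (E i c + (E i d + E i e)))))))) := by
    intro i
    rw [aux_sum _ hl rfl]; simp
  rw [aux_sum _ hl rfl] at htot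
  rw [aux_sum _ hl rfl] at hs
  simp only [List.map_cons, List.map_nil, List.sum_cons, List.sum_nil] at htot hs
  simp only [List.nodup_cons, List.mem_cons, not_or, List.not_mem_nil, not_false_eq_true] at hl
  obtain ⟨⟨nvp, nvq, nvr, nvs, nva, nvb, nvc, nvd, nve, -⟩, ⟨npq, npr, nps, npa, npb, npc, npd, npe, -⟩, ⟨nqr, nqs, nqa, nqb, nqc, nqd, nqe, -⟩, ⟨nrs, nra, nrb, nrc, nrd, nre, -⟩, ⟨nsa, nsb, nsc, nsd, nse, -⟩, ⟨nab, nac, nad, nae, -⟩, ⟨nbc, nbd, nbe, -⟩, ⟨ncd, nce, -⟩, ⟨nde, -⟩, -⟩ := hl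
  have K := aux_K4 (u p) (u q) (u r) (u s)
  have k1 := hEh p q npq h1
  have k2 := hEh p r npr h2
  have k3 := hEh p s nps h3
  have k4 := hEh q r nqr h4
  have k5 := hEh q s nqs h5
  have k6 := hEh r s nrs h6
  have k7 := hEh b c nbc h7
  have k8 := hEh c d ncd h8
  have k9 := hEh d e nde h9
  have rp : u p ^ 2 + E p q + E p r + E p s ≤ ∑ j, E p j := by
    rw [hrow, hEd]
    linarith [hEn p v, hEn p a, hEn p b, hEn p c, hEn p d, hEn p e]
  have rq : u q ^ 2 + E p q + E q r + E q s ≤ ∑ j, E q j := by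
    rw [hrow, hEd, hEs p q]
    linarith [hEn q v, hEn q a, hEn q b, hEn q c, hEn q d, hEn q e]
  have rr : u r ^ 2 + E p r + E q r + E r s ≤ ∑ j, E r j := by
    rw [hrow, hEd, hEs p r, hEs q r]
    linarith [hEn r v, hEn r a, hEn r b, hEn r c, hEn r d, hEn r e]
  have rs : u s ^ 2 + E p s + E q s + E r s ≤ ∑ j, E s j := by
    rw [hrow, hEd, hEs p s, hEs q s, hEs r s]
    linarith [hEn s v, hEn s a, hEn s b, hEn s c, hEn s d, hEn s e]
  have rc : u c ^ 2 + E b c + E c d ≤ ∑ j, E c j := by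
    rw [hrow, hEd, hEs b c]
    linarith [hEn c v, hEn c a, hEn c p, hEn c q, hEn c r, hEn c s, hEn c e]
  have rd : u d ^ 2 + E c d + E d e ≤ ∑ j, E d j := by
    rw [hrow, hEd, hEs c d]
    linarith [hEn d v, hEn d a, hEn d p, hEn d q, hEn d r, hEn d s, hEn d b]
  have rb : u b ^ 2 + E a b + E b c ≤ ∑ j, E b j := by
    rw [hrow, hEd, hEs a b]
    linarith [hEn b v, hEn b p, hEn b q, hEn b r, hEn b s, hEn b d, hEn b e]
  have re : u e ^ 2 + E e a + E d e ≤ ∑ j, E e j := by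
    rw [hrow, hEd, hEs d e]
    linarith [hEn e v, hEn e p, hEn e q, hEn e r, hEn e s, hEn e b, hEn e c]
  have ra : u a ^ 2 + E v a + E a b + E e a ≤ ∑ j, E a j := by
    rw [hrow, hEd, hEs v a, hEs e a]
    linarith [hEn a p, hEn a q, hEn a r, hEn a s, hEn a c, hEn a d]
  have rv : u v ^ 2 + E v a ≤ ∑ j, E v j := by
    rw [hrow, hEd]
    linarith [hEn v p, hEn v q, hEn v r, hEn v s, hEn v b, hEn v c, hEn v d, hEn v e]
  have n1 := hEn a b
  have n2 := hEn e a
  have n3 := hEn v a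
  obtain ⟨A, hA⟩ : ∃ A, A = u p + u q + u r + u s := ⟨_, rfl⟩
  rw [← hA] at K
  rcases h10 with h10 | ⟨h10, h11⟩
  · have k10 := hEh v a nva h10
    have P := aux_P4 (u b) (u c) (u d) (u e)
    obtain ⟨C, hC⟩ : ∃ C, C = u b + u c + u d + u e := ⟨_, rfl⟩
    obtain ⟨D, hD⟩ : ∃ D, D = u v + u a := ⟨_, rfl⟩
    rw [← hC] at P
    have Q : 3 / 4 * D ^ 2 ≤ u v ^ 2 + u a ^ 2 + u v * u a := by
      rw [hD]; exact aux_edge _ _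
    have hsum : D = 1 - A - C := by linarith
    have hfin : 5 / 8 * A ^ 2 + 5 / 12 * C ^ 2 + 3 / 4 * D ^ 2 ≤ 1 / 6 := by linarith
    rw [hsum] at hfin
    exact aux_fin1 A C hfin
  · have k10 := hEh a b nab h10
    have k11 := hEh e a (Ne.symm nae) h11
    have P := aux_C5 (u a) (u b) (u c) (u d) (u e)
    obtain ⟨C, hC⟩ : ∃ C, C = u a + u b + u c + u d + u e := ⟨_, rfl⟩
    rw [← hC] at P
    have hsum : u v = 1 - A - C := by linarith
    have hfin : 5 / 8 * A ^ 2 + 2 / 5 * C ^ 2 + u v ^ 2 ≤ 1 / 6 := by linarith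
    rw [hsum] at hfin
    exact aux_fin2 A C hfin

set_option maxHeartbeats 2000000 in
/-- A 2-coloring of `K₅` without monochromatic triangle has a red Hamilton cycle. -/
lemma aux_ham (red : Fin 10 → Fin 10 → Prop) (hsymm : ∀ i j, red i j ↔ red j i) (a b c d e : Fin 10)
    (hnd : [a, b, c, d, e].Nodup)
    (hB : ∀ x ∈ [a, b, c, d, e], ∀ y ∈ [a, b, c, d, e], ∀ z ∈ [a, b, c, d, e],
      x ≠ y → x ≠ z → y ≠ z → red x y ∨ red x z ∨ red y z)
    (hR : ∀ x ∈ [a, b, c, d, e], ∀ y ∈ [a, b, c, d, e], ∀ z ∈ [a, b, c, d, e],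
      x ≠ y → x ≠ z → y ≠ z → ¬ (red x y ∧ red x z ∧ red y z)) :
    ∃ p q r s, [a, p, q, r, s].Perm [a, b, c, d, e] ∧ red a p ∧ red p q ∧ red q r ∧ red r s
      ∧ red s a := by
  simp only [List.nodup_cons, List.mem_cons, not_or, List.not_mem_nil, not_false_eq_true] at hnd
  obtain ⟨⟨nab, nac, nad, nae, -⟩, ⟨nbc, nbd, nbe, -⟩, ⟨ncd, nce, -⟩, ⟨nde, -⟩, -⟩ := hnd
  have Babc := hB a (by simp) b (by simp) c (by simp) nab nac nbc
  have Rabc := hR a (by simp) b (by simp) c (by simp) nab nac nbc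
  have Babd := hB a (by simp) b (by simp) d (by simp) nab nad nbd
  have Rabd := hR a (by simp) b (by simp) d (by simp) nab nad nbd
  have Babe := hB a (by simp) b (by simp) e (by simp) nab nae nbe
  have Rabe := hR a (by simp) b (by simp) e (by simp) nab nae nbe
  have Bacd := hB a (by simp) c (by simp) d (by simp) nac nad ncd
  have Racd := hR a (by simp) c (by simp) d (by simp) nac nad ncd
  have Bace := hB a (by simp) c (by simp) e (by simp) nac nae nce
  have Race := hR a (by simp) c (by simp) e (by simp) nac nae nce
  have Bade := hB a (by simp) d (by simp) e (by simp) nad nae nde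
  have Rade := hR a (by simp) d (by simp) e (by simp) nad nae nde
  have Bbcd := hB b (by simp) c (by simp) d (by simp) nbc nbd ncd
  have Rbcd := hR b (by simp) c (by simp) d (by simp) nbc nbd ncd
  have Bbce := hB b (by simp) c (by simp) e (by simp) nbc nbe nce
  have Rbce := hR b (by simp) c (by simp) e (by simp) nbc nbe nce
  have Bbde := hB b (by simp) d (by simp) e (by simp) nbd nbe nde
  have Rbde := hR b (by simp) d (by simp) e (by simp) nbd nbe nde
  have Bcde := hB c (by simp) d (by simp) e (by simp) ncd nce nde
  have Rcde := hR c (by simp) d (by simp) e (by simp) ncd nce nde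
  clear hB hR
  have key : (red a b ∧ red b c ∧ red c d ∧ red d e ∧ red a e) ∨
      (red a b ∧ red b c ∧ red c e ∧ red d e ∧ red a d) ∨
      (red a b ∧ red b d ∧ red c d ∧ red c e ∧ red a e) ∨
      (red a b ∧ red b d ∧ red d e ∧ red c e ∧ red a c) ∨
      (red a b ∧ red b e ∧ red c e ∧ red c d ∧ red a d) ∨
      (red a b ∧ red b e ∧ red d e ∧ red c d ∧ red a c) ∨
      (red a c ∧ red b c ∧ red b d ∧ red d e ∧ red a e) ∨
      (red a c ∧ red b c ∧ red b e ∧ red d e ∧ red a d) ∨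
      (red a c ∧ red c d ∧ red b d ∧ red b e ∧ red a e) ∨
      (red a c ∧ red c e ∧ red b e ∧ red b d ∧ red a d) ∨
      (red a d ∧ red b d ∧ red b c ∧ red c e ∧ red a e) ∨
      (red a d ∧ red c d ∧ red b c ∧ red b e ∧ red a e) := by
    clear hsymm
    grind (splits := 40)
  rcases key with h | h | h | h | h | h | h | h | h | h | h | h
  · refine ⟨b, c, d, e, ?_, ?_⟩
    · rw [List.perm_iff_count]; intro x; simp only [List.count_cons]; try omega
    · grind
  · refine ⟨b, c, e, d, ?_, ?_⟩
    · rw [List.perm_iff_count]; intro x; simp only [List.count_cons]; try omega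
    · grind
  · refine ⟨b, d, c, e, ?_, ?_⟩
    · rw [List.perm_iff_count]; intro x; simp only [List.count_cons]; try omega
    · grind
  · refine ⟨b, d, e, c, ?_, ?_⟩
    · rw [List.perm_iff_count]; intro x; simp only [List.count_cons]; try omega
    · grind
  · refine ⟨b, e, c, d, ?_, ?_⟩
    · rw [List.perm_iff_count]; intro x; simp only [List.count_cons]; try omega
    · grind
  · refine ⟨b, e, d, c, ?_, ?_⟩
    · rw [List.perm_iff_count]; intro x; simp only [List.count_cons]; try omega
    · grind
  · refine ⟨c, b, d, e, ?_, ?_⟩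
    · rw [List.perm_iff_count]; intro x; simp only [List.count_cons]; try omega
    · grind
  · refine ⟨c, b, e, d, ?_, ?_⟩
    · rw [List.perm_iff_count]; intro x; simp only [List.count_cons]; try omega
    · grind
  · refine ⟨c, d, b, e, ?_, ?_⟩
    · rw [List.perm_iff_count]; intro x; simp only [List.count_cons]; try omega
    · grind
  · refine ⟨c, e, b, d, ?_, ?_⟩
    · rw [List.perm_iff_count]; intro x; simp only [List.count_cons]; try omega
    · grind
  · refine ⟨d, b, c, e, ?_, ?_⟩
    · rw [List.perm_iff_count]; intro x; simp only [List.count_cons]; try omega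
    · grind
  · refine ⟨d, c, b, e, ?_, ?_⟩
    · rw [List.perm_iff_count]; intro x; simp only [List.count_cons]; try omega
    · grind

set_option maxHeartbeats 2000000 in
/-- Claim 90: in a weighted 2-colored K₁₀ (weights in {1/2, 1}) with no blue triangle, no
red generalized K₆, and density at least 5/12, every vertex is incident to at least two
half edges. -/
theorem two_half_edges_K10 (w : Fin 10 → Fin 10 → ℝ) (red : Fin 10 → Fin 10 → Prop)
    (hwsymm : ∀ i j, w i j = w j i)
    (hwval : ∀ i j : Fin 10, i ≠ j → w i j = 1 / 2 ∨ w i j = 1)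
    (hredsymm : ∀ i j, red i j ↔ red j i)
    (hnoBlueTriangle : ∀ a b c : Fin 10, a ≠ b → a ≠ c → b ≠ c →
        red a b ∨ red a c ∨ red b c)
    (hnoRedGenK6 : ¬ ∃ X Y : Finset (Fin 10), Y ⊆ X ∧ X.card + Y.card = 6 ∧
        (∀ i ∈ X, ∀ j ∈ X, i ≠ j → red i j) ∧
        (∀ i ∈ Y, ∀ j ∈ Y, i ≠ j → w i j = 1))
    (hdens : ∃ u : Fin 10 → ℝ, (∀ i, 0 ≤ u i) ∧ ∑ i, u i = 1 ∧
        5 / 12 ≤ ∑ i, ∑ j, if i < j then w i j * u i * u j else 0) :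
    ∀ i : Fin 10, ∃ j k : Fin 10, j ≠ i ∧ k ≠ i ∧ j ≠ k ∧
      w i j = 1 / 2 ∧ w i k = 1 / 2 := by
  have T3 : ∀ a b c : Fin 10, a ≠ b → a ≠ c → b ≠ c → red a b → red a c → red b c →
      w a b = 1 → w a c = 1 → w b c = 1 → False := by
    intro a b c h1 h2 h3 h4 h5 h6 h7 h8 h9
    apply hnoRedGenK6
    refine ⟨{a, b, c}, {a, b, c}, subset_rfl, ?_, ?_, ?_⟩
    · rw [Finset.card_eq_three.2 ⟨a, b, c, h1, h2, h3, rfl⟩]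
    · intro i hi j hj hij
      simp only [Finset.mem_insert, Finset.mem_singleton] at hi hj
      rcases hi with rfl | rfl | rfl <;> rcases hj with rfl | rfl | rfl <;> grind
    · intro i hi j hj hij
      simp only [Finset.mem_insert, Finset.mem_singleton] at hi hj
      rcases hi with rfl | rfl | rfl <;> rcases hj with rfl | rfl | rfl <;> grind
  have T4 : ∀ X : Finset (Fin 10), X.card = 4 → (∀ i ∈ X, ∀ j ∈ X, i ≠ j → red i j) →
      ∀ a ∈ X, ∀ b ∈ X, a ≠ b → w a b = 1 / 2 := by
    intro X hX hr a ha b hb hab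
    rcases hwval a b hab with h | h
    · exact h
    · exfalso
      apply hnoRedGenK6
      refine ⟨X, {a, b}, ?_, ?_, hr, ?_⟩
      · intro x hx
        simp only [Finset.mem_insert, Finset.mem_singleton] at hx
        rcases hx with rfl | rfl <;> assumption
      · rw [hX, Finset.card_pair hab]
      · intro i hi j hj hij
        simp only [Finset.mem_insert, Finset.mem_singleton] at hi hj
        rcases hi with rfl | rfl <;> rcases hj with rfl | rfl <;> grind
  have T5 : ∀ X : Finset (Fin 10), (∀ i ∈ X, ∀ j ∈ X, i ≠ j → red i j) → X.card ≤ 4 := by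
    intro X hr
    by_contra hc
    obtain ⟨X', hX', hc'⟩ := Finset.exists_subset_card_eq (show 5 ≤ X.card by omega)
    obtain ⟨y, hy⟩ := Finset.card_pos.1 (show 0 < X'.card by omega)
    apply hnoRedGenK6
    refine ⟨X', {y}, by simpa using hy, by rw [hc']; simp,
      fun i hi j hj => hr i (hX' hi) j (hX' hj), ?_⟩
    intro i hi j hj hij
    simp only [Finset.mem_singleton] at hi hj
    exact absurd (hi.trans hj.symm) hij
  intro v
  by_contra hcon
  have hx : ∃ x, x ≠ v ∧ ∀ j, j ≠ v → j ≠ x → w v j = 1 := by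
    by_cases h : ∃ x, x ≠ v ∧ w v x = 1 / 2
    · obtain ⟨x, hxv, hx⟩ := h
      refine ⟨x, hxv, fun j hj hjx => ?_⟩
      rcases hwval v j hj.symm with h | h
      · exact absurd ⟨j, x, hj, hxv, hjx, h, hx⟩ hcon
      · exact h
    · obtain ⟨x, hxv⟩ := exists_ne v
      refine ⟨x, hxv, fun j hj hjx => ?_⟩
      rcases hwval v j hj.symm with h' | h'
      · exact absurd ⟨j, hj, h'⟩ h
      · exact h'
  obtain ⟨x, hxv, hx⟩ := hx
  classical
  obtain ⟨R, hRdef⟩ : ∃ R : Finset (Fin 10), R = (Finset.univ.erase v).filter (fun j => red v j) :=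
    ⟨_, rfl⟩
  obtain ⟨B, hBdef⟩ : ∃ B : Finset (Fin 10), B = (Finset.univ.erase v).filter (fun j => ¬ red v j) :=
    ⟨_, rfl⟩
  have hcard : R.card + B.card = 9 := by
    rw [hRdef, hBdef, Finset.card_filter_add_card_filter_not]; simp
  have hRm : ∀ j, j ∈ R ↔ j ≠ v ∧ red v j := by intro j; simp [hRdef]
  have hBm : ∀ j, j ∈ B ↔ j ≠ v ∧ ¬ red v j := by intro j; simp [hBdef]
  have hBred : ∀ i ∈ B, ∀ j ∈ B, i ≠ j → red i j := by
    intro i hi j hj hij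
    rw [hBm] at hi hj
    rcases hnoBlueTriangle v i j hi.1.symm hj.1.symm hij with h | h | h
    · exact absurd h hi.2
    · exact absurd h hj.2
    · exact h
  have hB4 := T5 B hBred
  have hRtri : ∀ a ∈ R, ∀ b ∈ R, ∀ c ∈ R, a ≠ b → a ≠ c → b ≠ c →
      ¬ (red a b ∧ red a c ∧ red b c) := by
    rintro a ha b hb c hc hab hac hbc ⟨rab, rac, rbc⟩
    rw [hRm] at ha hb hc
    have h4 := T4 {v, a, b, c} (by
      rw [Finset.card_insert_of_notMem, Finset.card_eq_three.2 ⟨a, b, c, hab, hac, hbc, rfl⟩]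
      simp only [Finset.mem_insert, Finset.mem_singleton]; grind) (by
      intro i hi j hj hij
      simp only [Finset.mem_insert, Finset.mem_singleton] at hi hj
      rcases hi with rfl | rfl | rfl | rfl <;> rcases hj with rfl | rfl | rfl | rfl <;>
        first | exact absurd rfl hij | tauto | (rw [hredsymm]; tauto))
    have ha2 := h4 v (by simp) a (by simp) ha.1.symm
    have hb2 := h4 v (by simp) b (by simp) hb.1.symm
    exact hcon ⟨a, b, ha.1, hb.1, hab, ha2, hb2⟩
  have hR5 : R.card ≤ 5 := by
    by_contra hc
    obtain ⟨a, ha⟩ := Finset.card_pos.1 (show 0 < R.card by omega)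
    have hsp := Finset.card_filter_add_card_filter_not (s := R.erase a) (fun j => red a j)
    rw [Finset.card_erase_of_mem ha] at hsp
    rcases le_or_gt 3 ((R.erase a).filter (fun j => red a j)).card with h | h
    · obtain ⟨p, q, r, hp, hq, hr, hpq, hpr, hqr⟩ := Finset.two_lt_card_iff.1 h
      simp only [Finset.mem_filter, Finset.mem_erase] at hp hq hr
      have t1 := hRtri a ha p hp.1.2 q hq.1.2 hp.1.1.symm hq.1.1.symm hpq
      have t2 := hRtri a ha p hp.1.2 r hr.1.2 hp.1.1.symm hr.1.1.symm hpr
      have t3 := hRtri a ha q hq.1.2 r hr.1.2 hq.1.1.symm hr.1.1.symm hqr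
      have t4 := hnoBlueTriangle p q r hpq hpr hqr
      rcases t4 with h | h | h
      · exact t1 ⟨hp.2, hq.2, h⟩
      · exact t2 ⟨hp.2, hr.2, h⟩
      · exact t3 ⟨hq.2, hr.2, h⟩
    · obtain ⟨p, q, r, hp, hq, hr, hpq, hpr, hqr⟩ := Finset.two_lt_card_iff.1
        (show 2 < ((R.erase a).filter (fun j => ¬ red a j)).card by omega)
      simp only [Finset.mem_filter, Finset.mem_erase] at hp hq hr
      have t1 := hnoBlueTriangle a p q hp.1.1.symm hq.1.1.symm hpq
      have t2 := hnoBlueTriangle a p r hp.1.1.symm hr.1.1.symm hpr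
      have t3 := hnoBlueTriangle a q r hq.1.1.symm hr.1.1.symm hqr
      have t4 := hRtri p hp.1.2 q hq.1.2 r hr.1.2 hpq hpr hqr
      exact t4 ⟨(t1.resolve_left hp.2).resolve_left hq.2, (t2.resolve_left hp.2).resolve_left hr.2,
        (t3.resolve_left hq.2).resolve_left hr.2⟩
  have hRc : R.card = 5 := by omega
  have hBc : B.card = 4 := by omega
  -- choose the base point of the pentagon
  have hbase : ∃ a ∈ R, ∀ j ∈ R, j ≠ a → j ≠ x := by
    by_cases hxR : x ∈ R
    · exact ⟨x, hxR, fun j _ h => h⟩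
    · obtain ⟨a, ha⟩ := Finset.card_pos.1 (show 0 < R.card by omega)
      exact ⟨a, ha, fun j hj _ h => hxR (h ▸ hj)⟩
  obtain ⟨a, haR, hax⟩ := hbase
  have hRe : (R.erase a).card = 4 := by rw [Finset.card_erase_of_mem haR, hRc]
  have list4 : ∀ S : Finset (Fin 10), S.card = 4 → ∃ p q r s, [p, q, r, s].Nodup ∧
      ∀ i, i ∈ S ↔ i ∈ [p, q, r, s] := by
    intro S hS
    have hlen : S.toList.length = 4 := by rw [Finset.length_toList, hS]
    obtain ⟨p, q, r, s, h⟩ := List.length_eq_four.1 hlen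
    exact ⟨p, q, r, s, h ▸ S.nodup_toList, fun i => by rw [← h, Finset.mem_toList]⟩
  obtain ⟨b, c, d, e, hnd, hmem⟩ := list4 _ hRe
  obtain ⟨p, q, r, s, hndB, hmemB⟩ := list4 _ hBc
  have hmemR : ∀ i, i ∈ [a, b, c, d, e] → i ∈ R := by
    intro i hi
    rcases List.mem_cons.1 hi with rfl | hi
    · exact haR
    · exact Finset.mem_of_mem_erase ((hmem i).2 hi)
  have hnd5 : [a, b, c, d, e].Nodup := by
    rw [List.nodup_cons]
    refine ⟨fun h => ?_, hnd⟩
    exact Finset.notMem_erase a R ((hmem a).2 h)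
  obtain ⟨b', c', d', e', hperm, r1, r2, r3, r4, r5⟩ := aux_ham red hredsymm a b c d e hnd5
    (fun i _ j _ k _ => hnoBlueTriangle i j k)
    (fun i hi j hj k hk => hRtri i (hmemR i hi) j (hmemR j hj) k (hmemR k hk))
  have hnd5' := hperm.nodup_iff.2 hnd5
  have hmemR' : ∀ i, i ∈ [a, b', c', d', e'] → i ∈ R := fun i hi => hmemR i (hperm.mem_iff.1 hi)
  have half : ∀ i ∈ R, ∀ j ∈ R, i ≠ j → red i j → w v i = 1 → w v j = 1 → w i j = 1 / 2 := by
    intro i hi j hj hij hr hwi hwj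
    rcases hwval i j hij with h | h
    · exact h
    · rw [hRm] at hi hj
      exact (T3 v i j hi.1.symm hj.1.symm hij hi.2 hj.2 hr hwi hwj h).elim
  have full : ∀ i ∈ R, i ≠ a → w v i = 1 := fun i hi hia =>
    hx i ((hRm i).1 hi).1 (hax i hi hia)
  have hall : [v, p, q, r, s, a, b', c', d', e'].Nodup := by
    have : (v :: ([p, q, r, s] ++ [a, b', c', d', e'])).Nodup := by
      rw [List.nodup_cons, List.nodup_append']
      refine ⟨fun h => ?_, hndB, hnd5', fun i hi hj => ?_⟩
      · rcases List.mem_append.1 h with h | h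
        · exact ((hBm v).1 ((hmemB v).2 h)).1 rfl
        · exact ((hRm v).1 (hmemR' v h)).1 rfl
      · exact ((hBm i).1 ((hmemB i).2 hi)).2 ((hRm i).1 (hmemR' i hj)).2
    exact this
  simp only [List.nodup_cons, List.mem_cons, not_or, List.not_mem_nil, not_false_eq_true]
    at hnd5' hndB
  obtain ⟨⟨nab, nac, nad, nae, -⟩, ⟨nbc, -, -, -⟩, ⟨ncd, -, -⟩, ⟨nde, -⟩, -⟩ := hnd5'
  obtain ⟨⟨npq, npr, nps, -⟩, ⟨nqr, nqs, -⟩, ⟨nrs, -⟩, -⟩ := hndB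
  have hb := hmemR' b' (by simp)
  have hc := hmemR' c' (by simp)
  have hd := hmemR' d' (by simp)
  have he := hmemR' e' (by simp)
  have hp := (hmemB p).2 (by simp)
  have hq := (hmemB q).2 (by simp)
  have hr := (hmemB r).2 (by simp)
  have hs := (hmemB s).2 (by simp)
  have wb := full b' hb (Ne.symm nab)
  have wc := full c' hc (Ne.symm nac)
  have wd := full d' hd (Ne.symm nad)
  have we := full e' he (Ne.symm nae)
  have HB := T4 B hBc hBred
  obtain ⟨u, hu, hsum, hdens⟩ := hdens
  refine aux_density w hwsymm hwval u hu hsum hdens v p q r s a b' c' d' e' hall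
    (HB p hp q hq npq) (HB p hp r hr npr) (HB p hp s hs nps)
    (HB q hq r hr nqr) (HB q hq s hs nqs) (HB r hr s hs nrs)
    (half b' hb c' hc nbc r2 wb wc) (half c' hc d' hd ncd r3 wc wd)
    (half d' hd e' he nde r4 wd we) ?_
  rcases hwval v a ((hRm a).1 haR).1.symm with h | h
  · exact Or.inl h
  · exact Or.inr ⟨half a haR b' hb nab r1 h wb, half e' he a haR (Ne.symm nae) r5 we h⟩
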